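/- Let (α,θ) ∈ Ω and let φ, β, G, U be as in the context. Then φ(U/2) = −π/2, β(U/2) = β(U)/2 and G(U/2) = G(U)/2. -/

import Mathlib

open Real Filter

noncomputable def Ccoef (α θ : ℝ) : ℝ := Real.sin (2 * θ) / (2 * α)

noncomputable def Ppoly (α θ x : ℝ) : ℝ :=
  α ^ 2 + Real.cos (2 * θ) * x ^ 2 - Ccoef α θ ^ 2 * x ^ 4

noncomputable def thetaPlus (α : ℝ) : ℝ :=
  if 1 < α then Real.pi / 2 else (1 / 2) * Real.arccos (1 - 2 * α ^ 2)

def inOmega (α θ : ℝ) : Prop := 0 < α ∧ -thetaPlus α < θ ∧ θ < thetaPlus α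

noncomputable def Lint (α θ : ℝ) : ℝ :=
  ∫ x in (-1 : ℝ)..1,
    (2 * α * Ccoef α θ ^ 2 * x ^ 2 - α * Real.cos (2 * θ)
        + Ccoef α θ ^ 2 * x ^ 2 * Real.sqrt (Ppoly α θ x)) /
      (Real.sqrt ((1 - x ^ 2) * Ppoly α θ x) * (α + Real.sqrt (Ppoly α θ x)))

/-- Wirtinger derivative `f_z = (f_u - i f_v)/2` of a map `f : ℝ² → ℂ`. -/
noncomputable def wz (f : ℝ × ℝ → ℂ) (p : ℝ × ℝ) : ℂ :=
  (deriv (fun t => f (t, p.2)) p.1 - Complex.I * deriv (fun t => f (p.1, t)) p.2) / 2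

/-- Wirtinger derivative `f_z̄ = (f_u + i f_v)/2` of a map `f : ℝ² → ℂ`. -/
noncomputable def wzbar (f : ℝ × ℝ → ℂ) (p : ℝ × ℝ) : ℂ :=
  (deriv (fun t => f (t, p.2)) p.1 + Complex.I * deriv (fun t => f (p.1, t)) p.2) / 2

theorem one_sub_lt_cos_of_inOmega {α θ : ℝ} (h : inOmega α θ) :
    1 - 2 * α ^ 2 < Real.cos (2 * θ) := by
  obtain ⟨hα, h1, h2⟩ := h
  by_cases hα1 : 1 < α
  · nlinarith [Real.neg_one_le_cos (2 * θ)]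
  · simp only [thetaPlus, if_neg hα1] at h1 h2
    have hlt : |2 * θ| < Real.arccos (1 - 2 * α ^ 2) := abs_lt.2 ⟨by linarith, by linarith⟩
    have hcos := Real.cos_lt_cos_of_nonneg_of_le_pi (abs_nonneg _) (Real.arccos_le_pi _) hlt
    rwa [Real.cos_abs, Real.cos_arccos (by nlinarith) (by nlinarith)] at hcos

theorem Ppoly_pos {α θ : ℝ} (h : inOmega α θ) {x : ℝ} (hx : x ^ 2 ≤ 1) : 0 < Ppoly α θ x := by
  have hα : 0 < α := h.1
  have hc := one_sub_lt_cos_of_inOmega h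
  have hα2 : 0 < α ^ 2 := by positivity
  have hC : 4 * α ^ 2 * Ccoef α θ ^ 2 = 1 - Real.cos (2 * θ) ^ 2 := by
    rw [← Real.sin_sq, Ccoef]
    field_simp
    ring
  have hone : 0 < α ^ 2 + Real.cos (2 * θ) - Ccoef α θ ^ 2 := by
    have hmul : 0 < 4 * α ^ 2 * (α ^ 2 + Real.cos (2 * θ) - Ccoef α θ ^ 2) := by
      nlinarith
    exact pos_of_mul_pos_right hmul (by positivity)
  have hsplit : Ppoly α θ x = α ^ 2 * (1 - x ^ 2)
      + x ^ 2 * (α ^ 2 + Real.cos (2 * θ) - Ccoef α θ ^ 2)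
      + Ccoef α θ ^ 2 * (x ^ 2 * (1 - x ^ 2)) := by
    rw [Ppoly]
    ring
  have h1 : 0 ≤ 1 - x ^ 2 := by linarith
  rw [hsplit]
  rcases h1.eq_or_lt with h0 | h0
  · have : x ^ 2 = 1 := by linarith
    rw [this]
    linarith
  · positivity

/-- The solution starting at `0` of an autonomous equation `f' = -v(f)`, with `v` positive,
continuous and even, is odd. -/
theorem odd_of_hasDerivAt_neg_comp {v f : ℝ → ℝ} (hv : Continuous v) (hpos : ∀ s, 0 < v s)
    (heven : ∀ s, v (-s) = v s) (hf : ∀ u, HasDerivAt f (-v (f u)) u) (hf0 : f 0 = 0) (u : ℝ) :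
    f (-u) = -f u := by
  set F : ℝ → ℝ := fun x => ∫ s in (0 : ℝ)..x, (v s)⁻¹ with hF
  have hcont : Continuous fun s => (v s)⁻¹ := hv.inv₀ fun s => (hpos s).ne'
  have hF' : ∀ x, HasDerivAt F (v x)⁻¹ x := fun x => hcont.integral_hasStrictDerivAt 0 x
    |>.hasDerivAt
  have hmono : StrictMono F := strictMono_of_hasDerivAt_pos hF' fun x => inv_pos.2 (hpos x)
  have hodd : ∀ x, F (-x) = -F x := by
    intro x
    have := intervalIntegral.integral_comp_neg (a := 0) (b := x) fun s => (v s)⁻¹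
    simp only [heven, neg_zero] at this
    simp only [hF]
    rw [this, intervalIntegral.integral_symm]
  have hFf : ∀ w, F (f w) = -w := by
    intro w
    have hd : ∀ t, HasDerivAt (fun t => F (f t) + t) 0 t := by
      intro t
      refine (((hF' (f t)).comp t (hf t)).add (hasDerivAt_id t)).congr_deriv ?_
      rw [mul_neg, inv_mul_cancel₀ (hpos (f t)).ne', neg_add_cancel]
    have := is_const_of_deriv_eq_zero (fun t => (hd t).differentiableAt)
      (fun t => (hd t).deriv) w 0
    simp only [hf0, hF, intervalIntegral.integral_same] at this
    simp only [hF]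
    linarith
  apply hmono.injective
  rw [hFf, hodd, hFf]

/-- A primitive vanishing at `0` of a function symmetric about `U / 2` takes at `U / 2` half
its value at `U`. -/
theorem eq_half_of_hasDerivAt_symm {f g : ℝ → ℝ} {U : ℝ} (hf : ∀ u, HasDerivAt f (g u) u)
    (hf0 : f 0 = 0) (hg : ∀ u, g (U - u) = g u) : f (U / 2) = f U / 2 := by
  have hd : ∀ t, HasDerivAt (fun t => f t + f (U - t)) 0 t := by
    intro t
    refine ((hf t).add ((hf (U - t)).comp_const_sub U t)).congr_deriv ?_
    rw [hg, add_neg_cancel]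
  have := is_const_of_deriv_eq_zero (fun t => (hd t).differentiableAt)
    (fun t => (hd t).deriv) (U / 2) 0
  simp only [hf0, sub_half, sub_zero] at this
  linarith

/-- `φ(U/2) = -π/2`, `β(U/2) = β(U)/2` and `G(U/2) = G(U)/2`. -/
theorem statement_4 {α θ : ℝ} (hΩ : inOmega α θ) (φ φ' β G : ℝ → ℝ)
    (hφ : ∀ u, HasDerivAt φ (φ' u) u) (hφ'c : Continuous φ')
    (hode : ∀ u, (φ' u) ^ 2 = Ppoly α θ (Real.cos (φ u)))
    (hφ0 : φ 0 = 0) (hφ'0 : φ' 0 ≤ 0)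
    (hβ : ∀ u, HasDerivAt β (Ccoef α θ * Real.cos (φ u) ^ 2) u) (hβ0 : β 0 = 0)
    (hG : ∀ u, HasDerivAt G
      ((Ccoef α θ ^ 2 * Real.cos (φ u) ^ 2 - Real.cos (2 * θ)) / (α - φ' u)) u)
    (hG0 : G 0 = 0)
    (U : ℝ) (hU : 0 < U) (hUper : ∀ u, φ (u + U) = φ u - Real.pi) :
    φ (U / 2) = -(Real.pi / 2) ∧ β (U / 2) = β U / 2 ∧ G (U / 2) = G U / 2 := by
  have hP : ∀ s, 0 < Ppoly α θ (Real.cos s) := fun s => Ppoly_pos hΩ (Real.cos_sq_le_one s)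
  have hne : ∀ u, φ' u ≠ 0 := by
    intro u h0
    have := hode u
    rw [h0] at this
    have := hP (φ u)
    simp_all
  have hneg : ∀ u, φ' u < 0 := by
    intro u
    by_contra! hu
    obtain ⟨t, ht⟩ := mem_range_of_exists_le_of_exists_ge hφ'c ⟨0, hφ'0⟩ ⟨u, hu⟩
    exact hne t ht
  have hφ'_eq : ∀ u, φ' u = -Real.sqrt (Ppoly α θ (Real.cos (φ u))) := by
    intro u
    rw [← hode, Real.sqrt_sq_eq_abs, abs_of_neg (hneg u), neg_neg]
  have hodd : ∀ u, φ (-u) = -φ u :=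
    odd_of_hasDerivAt_neg_comp (v := fun s => Real.sqrt (Ppoly α θ (Real.cos s)))
      (by unfold Ppoly; fun_prop) (fun s => Real.sqrt_pos.2 (hP s))
      (fun s => by simp only [Real.cos_neg]) (fun u => hφ'_eq u ▸ hφ u) hφ0
  have hrefl : ∀ u, φ (U - u) = -φ u - Real.pi := by
    intro u
    rw [← hodd, ← hUper]
    congr 1
    ring
  have hcos : ∀ u, Real.cos (φ (U - u)) = -Real.cos (φ u) := by
    intro u
    rw [hrefl, Real.cos_sub_pi, Real.cos_neg]
  have hφ'_symm : ∀ u, φ' (U - u) = φ' u := by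
    intro u
    rw [hφ'_eq, hφ'_eq, hcos, Ppoly, Ppoly]
    congr 2
    ring
  refine ⟨?_, eq_half_of_hasDerivAt_symm hβ hβ0 fun u => ?_,
    eq_half_of_hasDerivAt_symm hG hG0 fun u => ?_⟩
  · have := hrefl (U / 2)
    rw [sub_half] at this
    linarith
  · rw [hcos, neg_sq]
  · rw [hcos, neg_sq, hφ'_symm]
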